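/- arXiv:2411.02222 — 2 statements merged into one kernel-verified Lean document; each statement's English description precedes it below -/
import Mathlib

section
/- Fix integers p, q ≥ 1 and set n = p + q + 1. In the braid group B_{n+2}, let X = σ_1 σ_2 ⋯ σ_{p+1} · σ_1 and Y = σ_{p+2} σ_{p+3} ⋯ σ_{n+1} · σ_{p+2}. Then X^{p+1} commutes with Y X^p Y^{-1} X Y; equivalently, the commutator [X^{p+1}, Y X^p Y^{-1} X Y] is trivial in B_{n+2}. -/
/-- The braid relations on `m - 1` generators: `PresentedGroup (braidRels m)` is the braid
group `B_m`.  The generator `i : Fin (m - 1)` corresponds to the standard generator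
`σ_{i+1}` (in the usual 1-based numbering `σ_1, …, σ_{m-1}`). -/
def braidRels (m : ℕ) : Set (FreeGroup (Fin (m - 1))) :=
  {r | (∃ i j : Fin (m - 1), (i : ℕ) + 1 = (j : ℕ) ∧
          r = FreeGroup.of i * FreeGroup.of j * FreeGroup.of i *
              (FreeGroup.of j * FreeGroup.of i * FreeGroup.of j)⁻¹) ∨
       (∃ i j : Fin (m - 1), (i : ℕ) + 2 ≤ (j : ℕ) ∧
          r = FreeGroup.of i * FreeGroup.of j * (FreeGroup.of j * FreeGroup.of i)⁻¹)}

/-- The braid group on `m` strands, presented by generators `σ_1, …, σ_{m-1}` with the braid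
relations. -/
def BraidGroup (m : ℕ) : Type := PresentedGroup (braidRels m)

instance (m : ℕ) : Group (BraidGroup m) := by unfold BraidGroup; infer_instance

/-- The standard generator `σ_j` of `B_m`, for `1 ≤ j ≤ m - 1` (and junk value `1` otherwise). -/
def σ (m j : ℕ) : BraidGroup m :=
  if h : 1 ≤ j ∧ j ≤ m - 1 then PresentedGroup.of ⟨j - 1, by omega⟩ else 1

/-- `σ_{[i,j]} = σ_i σ_{i+1} ⋯ σ_j` if `i ≤ j`, and `1` if `i > j`. -/
def σI (m i j : ℕ) : BraidGroup m := ((List.range' i (j + 1 - i)).map (σ m)).prod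

/-- `σ̄_{[i,j]} = σ_j σ_{j-1} ⋯ σ_i` if `i ≤ j`, and `1` if `i > j`. -/
def σIrev (m i j : ℕ) : BraidGroup m := ((List.range' i (j + 1 - i)).reverse.map (σ m)).prod

/-- The Dehn twist braid `twist_k = (σ_{[1,k-1]} σ_1)^{k-1}`. -/
def twist (m k : ℕ) : BraidGroup m := (σI m 1 (k - 1) * σ m 1) ^ (k - 1)

/-- The point-push braid `push_k = σ̄_{[1,k-1]} σ_{[1,k-1]}`. -/
def push (m k : ℕ) : BraidGroup m := σIrev m 1 (k - 1) * σI m 1 (k - 1)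

namespace BraidAux

variable {G : Type*} [Group G]

/-- `C g k = g 1 * ⋯ * g k`. -/
def C (g : ℕ → G) : ℕ → G
  | 0 => 1
  | k + 1 => C g k * g (k + 1)

/-- `R g k = g k * ⋯ * g 1`. -/
def R (g : ℕ → G) : ℕ → G
  | 0 => 1
  | k + 1 => g (k + 1) * R g k

/-- `Q g k j = g (k+1) * g k * ⋯` with `j` factors. -/
def Q (g : ℕ → G) (k : ℕ) : ℕ → G
  | 0 => 1
  | j + 1 => Q g k j * g (k + 1 - j)

/-- The braid relations for `g 1, …, g N`. -/
structure Br (g : ℕ → G) (N : ℕ) : Prop where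
  hb : ∀ i, 1 ≤ i → i + 1 ≤ N → g i * g (i + 1) * g i = g (i + 1) * g i * g (i + 1)
  hc : ∀ i j, i + 2 ≤ j → Commute (g i) (g j)

variable {g : ℕ → G} {N : ℕ}

/-- An element commuting with `g 1, …, g k` commutes with their product. -/
lemma comm_C_of (x : G) (k : ℕ) (h : ∀ i, 1 ≤ i → i ≤ k → Commute x (g i)) :
    Commute x (C g k) := by
  induction k with
  | zero => exact Commute.one_right x
  | succ k ih =>
    exact (ih fun i h1 h2 => h i h1 (by omega)).mul_right (h _ (by omega) le_rfl)

lemma comm_C (H : Br g N) (k j : ℕ) (h : k + 2 ≤ j) : Commute (g j) (C g k) :=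
  comm_C_of _ _ fun i _ _ => (H.hc i j (by omega)).symm

lemma shift (H : Br g N) (k : ℕ) (hk : k ≤ N) (i : ℕ) (hi : 1 ≤ i) (hik : i + 1 ≤ k) :
    C g k * g i = g (i + 1) * C g k := by
  induction k with
  | zero => omega
  | succ k ih =>
    rcases Nat.lt_or_ge i k with h | h
    · have h1 : g (k + 1) * g i = g i * g (k + 1) := (H.hc i (k + 1) (by omega)).symm.eq
      rw [C, mul_assoc, h1, ← mul_assoc, ih (by omega) (by omega), mul_assoc]
    · obtain rfl : i = k := by omega
      obtain ⟨l, rfl⟩ : ∃ l, i = l + 1 := ⟨i - 1, by omega⟩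
      have h1 := H.hb (l + 1) (by omega) hk
      have h2 := (comm_C H l (l + 1 + 1) (by omega)).eq
      simp only [C]
      rw [mul_assoc, mul_assoc, ← mul_assoc (g (l + 1)), h1, mul_assoc, ← mul_assoc (C g l), ← h2]
      simp only [mul_assoc]

lemma shift_C (H : Br g N) (k : ℕ) (hk : k ≤ N) (j : ℕ) (hj : j + 1 ≤ k) :
    g 1 * C g k * C g j = C g (j + 1) * C g k := by
  induction j with
  | zero => simp [C]
  | succ j ih =>
    have h1 := shift H k hk (j + 1) (by omega) hj
    rw [C, ← mul_assoc, ih (by omega), mul_assoc, h1, ← mul_assoc]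
    rfl

lemma shift_pow (H : Br g N) (k : ℕ) (hk : k ≤ N) (i j : ℕ) (hi : 1 ≤ i) (hj : i + j ≤ k) :
    C g k ^ j * g i = g (i + j) * C g k ^ j := by
  induction j with
  | zero => simp
  | succ j ih =>
    rw [pow_succ', mul_assoc, ih (by omega), ← mul_assoc, shift H k hk (i + j) (by omega) (by omega)]
    simp only [mul_assoc, add_assoc]

lemma wrap (H : Br g N) (k : ℕ) (hk : k ≤ N) (h1 : 1 ≤ k) :
    C g k ^ 2 * g k = g 1 * C g k ^ 2 := by
  obtain ⟨l, rfl⟩ : ∃ l, k = l + 1 := ⟨k - 1, by omega⟩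
  have h := shift_C H (l + 1) hk l le_rfl
  rw [sq, ← mul_assoc (g 1)]
  conv_rhs => rw [C, ← mul_assoc, ← C, h]

/-- The full twist. -/
def T (g : ℕ → G) (k : ℕ) : G := C g k ^ (k + 1)

lemma T_comm (H : Br g N) (k : ℕ) (hk : k ≤ N) (i : ℕ) (hi : 1 ≤ i) (hik : i ≤ k) :
    Commute (T g k) (g i) := by
  obtain ⟨a, rfl⟩ : ∃ a, i = 1 + a := ⟨i - 1, by omega⟩
  obtain ⟨b, rfl⟩ : ∃ b, k = 1 + a + b := ⟨k - (1 + a), by omega⟩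
  have e : T g (1 + a + b) = C g (1 + a + b) ^ a * C g (1 + a + b) ^ 2 * C g (1 + a + b) ^ b := by
    rw [T, ← pow_add, ← pow_add]; congr 1; omega
  have h1 := shift_pow H _ hk (1 + a) b (by omega) le_rfl
  have h2 := wrap H _ hk (by omega)
  have h3 := shift_pow H _ hk 1 a (by omega) (by omega)
  show _ * _ = _ * _
  rw [e, mul_assoc, h1, ← mul_assoc, mul_assoc (_ ^ a), h2, ← mul_assoc, h3]
  simp only [mul_assoc]

lemma X_pow (H : Br g N) (k : ℕ) (hk : k ≤ N) (j : ℕ) (hj : j + 1 ≤ k) :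
    g 1 * (C g k * g 1) ^ j = C g (j + 1) * C g k ^ j := by
  induction j with
  | zero => simp [C]
  | succ j ih =>
    rw [pow_succ', ← mul_assoc, ← mul_assoc, mul_assoc (g 1 * C g k), ih (by omega),
      ← mul_assoc, shift_C H k hk (j + 1) hj, mul_assoc, pow_succ']

lemma X_T (H : Br g N) (k : ℕ) (hk : k ≤ N) (h1 : 1 ≤ k) :
    (C g k * g 1) ^ k = T g k := by
  obtain ⟨l, rfl⟩ : ∃ l, k = l + 1 := ⟨k - 1, by omega⟩
  rw [pow_succ', mul_assoc, X_pow H _ hk l le_rfl, T, pow_succ', pow_succ']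

lemma Q_C (H : Br g N) (k : ℕ) (hk : k + 1 ≤ N) (j : ℕ) (hj : j ≤ k) :
    Q g k j * C g (k + 1) = C g k * Q g k (j + 1) := by
  induction j with
  | zero => simp [Q, C]
  | succ j ih =>
    have h := shift H (k + 1) hk (k - j) (by omega) (by omega)
    have e : k - j + 1 = k + 1 - j := by omega
    have e2 : k + 1 - (j + 1) = k - j := by omega
    rw [e] at h
    rw [Q, mul_assoc, ← h, ← mul_assoc, ih (by omega), Q, mul_assoc]
    conv_rhs => rw [Q, Q, e2]
    

lemma C_pow (H : Br g N) (k : ℕ) (hk : k + 1 ≤ N) (j : ℕ) (hj : j ≤ k + 1) :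
    C g (k + 1) ^ j = C g k ^ j * Q g k j := by
  induction j with
  | zero => simp [Q]
  | succ j ih =>
    rw [pow_succ, ih (by omega), mul_assoc, Q_C H k hk j (by omega), ← mul_assoc, ← pow_succ]

lemma Q_R (k j : ℕ) (hj : j ≤ k + 1) : Q g k j * R g (k + 1 - j) = R g (k + 1) := by
  induction j with
  | zero => simp [Q]
  | succ j ih =>
    rw [← ih (by omega)]
    obtain ⟨b, rfl⟩ : ∃ b, k = j + b := ⟨k - j, by omega⟩
    have e1 : j + b + 1 - j = b + 1 := by omega
    have e2 : j + b + 1 - (j + 1) = b := by omega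
    rw [Q, e1, e2, R, mul_assoc]

lemma T_succ (H : Br g N) (k : ℕ) (hk : k + 1 ≤ N) :
    T g (k + 1) = T g k * (R g (k + 1) * C g (k + 1)) := by
  have h := Q_R (g := g) k (k + 1) le_rfl
  rw [Nat.sub_self, R, mul_one] at h
  rw [T, pow_succ, C_pow H k hk (k + 1) le_rfl, h, mul_assoc, T]

/-- The full twist `T` commutes with `s T s`, where `s` is the next generator. -/
lemma T_sTs (H : Br g N) (k : ℕ) (hk : k + 1 ≤ N) (h1 : 1 ≤ k) :
    Commute (T g k) (g (k + 1) * T g k * g (k + 1)) := by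
  obtain ⟨l, rfl⟩ : ∃ l, k = l + 1 := ⟨k - 1, by omega⟩
  have e1 := T_succ H l (by omega)
  have e2 := T_succ H (l + 1) hk
  have c1 : Commute (g (l + 2)) (T g l) := (comm_C H l (l + 2) le_rfl).pow_right _
  have c2 : Commute (T g (l + 1)) (T g l) :=
    (comm_C_of _ _ fun i hi hil => T_comm H (l + 1) (by omega) i hi (by omega)).pow_right _
  have c3 : Commute (T g (l + 1)) (T g (l + 2)) :=
    ((comm_C_of _ _ fun i hi hil => T_comm H (l + 2) hk i hi (by omega)).pow_right _).symm
  have key : g (l + 2) * T g (l + 1) * g (l + 2) = T g l * ((T g (l + 1))⁻¹ * T g (l + 2)) := by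
    have : T g (l + 2) = T g (l + 1) * (g (l + 2) * (R g (l + 1) * C g (l + 1)) * g (l + 2)) := by
      rw [e2, R, C.eq_2 g (l + 1)]; simp only [mul_assoc]
    rw [this, inv_mul_cancel_left]
    conv_lhs => rw [e1, ← mul_assoc, c1.eq]
    simp only [mul_assoc]
  show Commute _ (g (l + 2) * T g (l + 1) * g (l + 2))
  rw [key]
  exact c2.mul_right ((Commute.refl _).inv_right.mul_right c3)

/-- The main computation. -/
lemma main (H : Br g N) (k : ℕ) (hk : k + 2 ≤ N) (h2 : 2 ≤ k) (X Y Z : G)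
    (hX : X = C g k * g 1) (hY : Y = g (k + 1) * (g (k + 2) * Z) * g (k + 1))
    (hZ : ∀ i, i ≤ k + 1 → Commute (g i) Z) :
    Commute (X ^ k) (Y * X ^ (k - 1) * Y⁻¹ * X * Y) := by
  have hT : X ^ k = T g k := by rw [hX, X_T H k (by omega) (by omega)]
  have cTg : ∀ i, 1 ≤ i → i ≤ k → Commute (T g k) (g i) := fun i a b =>
    T_comm H k (by omega) i a b
  -- the tail commutes with X and T
  have cZX : Commute Z X := by
    rw [hX]
    exact (comm_C_of _ _ fun i _ _ => (hZ i (by omega)).symm).mul_right (hZ 1 (by omega)).symm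
  have ctX : Commute (g (k + 2)) X := by
    rw [hX]
    exact (comm_C H k _ le_rfl).mul_right (H.hc 1 (k + 2) (by omega)).symm
  have hY2 : Y = g (k + 2) * g (k + 1) * (g (k + 2) * Z) := by
    have hb := H.hb (k + 1) (by omega) hk
    have hz := (hZ (k + 1) le_rfl).eq
    rw [hY]
    calc g (k + 1) * (g (k + 2) * Z) * g (k + 1)
        = g (k + 1) * g (k + 2) * (Z * g (k + 1)) := by simp only [mul_assoc]
      _ = (g (k + 1) * g (k + 2) * g (k + 1)) * Z := by rw [← hz]; simp only [mul_assoc]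
      _ = _ := by rw [hb]; simp only [mul_assoc]
  have hXk : X ^ (k - 1) = T g k * X⁻¹ := by
    rw [← hT, eq_mul_inv_iff_mul_eq, ← pow_succ]; congr 1; omega
  -- X⁻¹ s⁻¹ X s = s σ₁⁻¹ σₖ⁻¹ σ₁
  have hs : X⁻¹ * (g (k + 1))⁻¹ * X * g (k + 1) = g (k + 1) * ((g 1)⁻¹ * (g k)⁻¹ * g 1) := by
    have hsh : C g k * g (k + 1) * g k = g (k + 1) * (C g k * g (k + 1)) :=
      shift H (k + 1) (by omega) k (by omega) le_rfl
    have h1s : g 1 * g (k + 1) = g (k + 1) * g 1 := (H.hc 1 (k + 1) (by omega)).eq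
    have h1s' : g (k + 1) * (g 1)⁻¹ = (g 1)⁻¹ * g (k + 1) :=
      ((H.hc 1 (k + 1) (by omega)).symm.inv_right).eq
    have hh : (g (k + 1))⁻¹ * (C g k * g (k + 1)) = C g k * g (k + 1) * (g k)⁻¹ := by
      rw [inv_mul_eq_iff_eq_mul, ← mul_assoc, ← hsh, mul_inv_cancel_right]
    rw [hX]
    calc (C g k * g 1)⁻¹ * (g (k + 1))⁻¹ * (C g k * g 1) * g (k + 1)
        = (C g k * g 1)⁻¹ * (g (k + 1))⁻¹ * C g k * (g 1 * g (k + 1)) := by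
          simp only [mul_assoc]
      _ = (C g k * g 1)⁻¹ * ((g (k + 1))⁻¹ * (C g k * g (k + 1))) * g 1 := by
          rw [h1s]; simp only [mul_assoc]
      _ = (g 1)⁻¹ * g (k + 1) * (g k)⁻¹ * g 1 := by rw [hh]; group
      _ = _ := by rw [← h1s']; simp only [mul_assoc]
  set W := g (k + 2) * Z with hW
  have cWX : Commute W X := ctX.mul_left cZX
  have cWXk : Commute W (X ^ (k - 1)) := cWX.pow_right _
  have goal_eq : Y * X ^ (k - 1) * Y⁻¹ * X * Y =
      g (k + 2) * ((g (k + 1) * T g k * g (k + 1)) * ((g 1)⁻¹ * (g k)⁻¹ * g 1)) * W := by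
    have a1 : W * X ^ (k - 1) * W⁻¹ = X ^ (k - 1) := by rw [cWXk.eq, mul_inv_cancel_right]
    have a2 : (g (k + 2))⁻¹ * X * g (k + 2) = X := by
      rw [mul_assoc, ← ctX.eq, inv_mul_cancel_left]
    calc Y * X ^ (k - 1) * Y⁻¹ * X * Y
        = g (k + 2) * g (k + 1) * (W * X ^ (k - 1) * W⁻¹) * (g (k + 1))⁻¹ *
            ((g (k + 2))⁻¹ * X * g (k + 2)) * g (k + 1) * W := by rw [hY2]; group
      _ = g (k + 2) * g (k + 1) * T g k * (X⁻¹ * (g (k + 1))⁻¹ * X * g (k + 1)) * W := by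
          rw [a1, a2, hXk]; simp only [mul_assoc]
      _ = _ := by rw [hs]; simp only [mul_assoc]
  rw [goal_eq, hT]
  have ctT : Commute (T g k) (g (k + 2)) := by rw [← hT]; exact (ctX.pow_right k).symm
  have cTW : Commute (T g k) W := by rw [← hT]; exact (cWX.pow_right k).symm
  have c1 := cTg 1 le_rfl (by omega)
  have ck := cTg k (by omega) le_rfl
  exact (ctT.mul_right ((T_sTs H k (by omega) (by omega)).mul_right
    ((c1.inv_right.mul_right ck.inv_right).mul_right c1))).mul_right cTW

lemma C_eq (g : ℕ → G) (k : ℕ) : ((List.range' 1 k).map g).prod = C g k := by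
  induction k with
  | zero => simp [C]
  | succ k ih => rw [List.range'_1_concat, List.map_append, List.prod_append, ih, C]; simp [add_comm]

end BraidAux

lemma braid_rel_one (m : ℕ) {r : FreeGroup (Fin (m - 1))} (h : r ∈ braidRels m) :
    PresentedGroup.mk (braidRels m) r = 1 :=
  PresentedGroup.one_of_mem h

lemma σ_pos (m j : ℕ) (h : 1 ≤ j ∧ j ≤ m - 1) :
    σ m j = (PresentedGroup.mk (braidRels m) (FreeGroup.of ⟨j - 1, by omega⟩) : BraidGroup m) :=
  dif_pos h

lemma σ_neg (m j : ℕ) (h : ¬ (1 ≤ j ∧ j ≤ m - 1)) : σ m j = 1 := dif_neg h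

lemma braid_Br (m : ℕ) : BraidAux.Br (σ m) (m - 1) where
  hb i h1 h2 := by
    have a : 1 ≤ i ∧ i ≤ m - 1 := ⟨h1, by omega⟩
    have b : 1 ≤ i + 1 ∧ i + 1 ≤ m - 1 := ⟨by omega, h2⟩
    rw [σ_pos m _ a, σ_pos m _ b]
    have h := braid_rel_one m (Or.inl ⟨⟨i - 1, by omega⟩, ⟨i + 1 - 1, by omega⟩,
      by simp only; omega, rfl⟩)
    rw [map_mul, map_inv, mul_inv_eq_one] at h
    simp only [map_mul] at h
    exact h
  hc i j hij := by
    by_cases a : 1 ≤ i ∧ i ≤ m - 1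
    · by_cases b : 1 ≤ j ∧ j ≤ m - 1
      · rw [σ_pos m _ a, σ_pos m _ b]
        have h := braid_rel_one m (Or.inr ⟨⟨i - 1, by omega⟩, ⟨j - 1, by omega⟩,
          by simp only; omega, rfl⟩)
        rw [map_mul, map_inv, mul_inv_eq_one] at h
        simp only [map_mul] at h
        exact h
      · rw [σ_neg m _ b]; exact Commute.one_right _
    · rw [σ_neg m _ a]; exact Commute.one_left _

/-- For `p, q ≥ 1`, `n = p + q + 1`, in `B_{n+2}` the elements
`X = σ_1 ⋯ σ_{p+1} σ_1` and `Y = σ_{p+2} ⋯ σ_{n+1} σ_{p+2}` satisfy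
`[X^{p+1}, Y X^p Y⁻¹ X Y] = 1`, i.e. they commute. -/
theorem kernel_element_commutes (p q : ℕ) (hp : 1 ≤ p) (hq : 1 ≤ q) (n : ℕ)
    (hn : n = p + q + 1) (X Y : BraidGroup (n + 2))
    (hX : X = σI (n + 2) 1 (p + 1) * σ (n + 2) 1)
    (hY : Y = σI (n + 2) (p + 2) (n + 1) * σ (n + 2) (p + 2)) :
    Commute (X ^ (p + 1)) (Y * X ^ p * Y⁻¹ * X * Y) := by
  have H := braid_Br (n + 2)
  have e : n + 1 + 1 - (p + 2) = (q - 1) + 1 + 1 := by omega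
  refine BraidAux.main H (p + 1) (by omega) (by omega) X Y
    ((List.range' (p + 4) (q - 1)).map (σ (n + 2))).prod ?_ ?_ ?_
  · rw [hX, σI, ← BraidAux.C_eq]; rfl
  · rw [hY, σI, e, List.range'_succ, List.range'_succ]
    simp only [List.map_cons, List.prod_cons]
  · intro i hi
    apply Commute.list_prod_right
    intro x hx
    obtain ⟨j, hj, rfl⟩ := List.mem_map.1 hx
    rw [List.mem_range'_1] at hj
    exact H.hc i j (by omega)
end

section
/- Fix integers p, q ≥ 1 and set n = p + q + 1. In the braid group B_{n+2}, let X = σ_{[1,p+1]} σ_1 and Y = σ_{[p+2,n+1]} σ_{p+2}. Then the identity Y X^p Y^{-1} X Y = twist_{p+1} · σ_1^{-1} σ_{p+1}^{-1} σ_1 · σ_{p+3} · push_{p+3} · σ_{[p+3,n+1]} holds. -/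
theorem sigma_eq (m i : ℕ) (h1 : 1 ≤ i) (h2 : i ≤ m - 1) :
    σ m i = (PresentedGroup.of ⟨i - 1, by omega⟩ : PresentedGroup (braidRels m)) :=
  dif_pos ⟨h1, h2⟩

theorem sigma_braid (m i : ℕ) (h1 : 1 ≤ i) (h2 : i + 1 ≤ m - 1) :
    σ m i * σ m (i + 1) * σ m i = σ m (i + 1) * σ m i * σ m (i + 1) := by
  rw [sigma_eq m i h1 (by omega), sigma_eq m (i + 1) (by omega) h2]
  have hr := PresentedGroup.one_of_mem (rels := braidRels m)
    (Or.inl ⟨⟨i - 1, by omega⟩, ⟨i + 1 - 1, by omega⟩, by simp; omega, rfl⟩)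
  rw [map_mul, map_inv, mul_inv_eq_one] at hr
  simp only [map_mul] at hr
  exact hr

theorem sigma_comm (m i j : ℕ) (h1 : 1 ≤ i) (h2 : i + 2 ≤ j) (h3 : j ≤ m - 1) :
    σ m i * σ m j = σ m j * σ m i := by
  rw [sigma_eq m i h1 (by omega), sigma_eq m j (by omega) h3]
  have hr := PresentedGroup.one_of_mem (rels := braidRels m)
    (Or.inr ⟨⟨i - 1, by omega⟩, ⟨j - 1, by omega⟩, by simp; omega, rfl⟩)
  rw [map_mul, map_inv, mul_inv_eq_one] at hr
  simp only [map_mul] at hr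
  exact hr

section abstractBraid

/-- `s 1 * ⋯ * s k` -/
def upProd {G : Type*} [Group G] (s : ℕ → G) : ℕ → G
  | 0 => 1
  | k + 1 => upProd s k * s (k + 1)

/-- `s k * ⋯ * s 1` -/
def downProd {G : Type*} [Group G] (s : ℕ → G) : ℕ → G
  | 0 => 1
  | k + 1 => s (k + 1) * downProd s k

/-- `s k * s (k-1) * ⋯` with `j` factors -/
def partProd {G : Type*} [Group G] (s : ℕ → G) (k : ℕ) : ℕ → G
  | 0 => 1
  | j + 1 => partProd s k j * s (k - j)

variable {G : Type*} [Group G] (s : ℕ → G) (N : ℕ)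

theorem up_comm
    (hc : ∀ i j, 1 ≤ i → i + 2 ≤ j → j ≤ N → Commute (s i) (s j))
    (k j : ℕ) (h : k + 2 ≤ j) (hj : j ≤ N) : Commute (upProd s k) (s j) := by
  induction k with
  | zero => exact Commute.one_left _
  | succ k ih => exact (ih (by omega)).mul_left (hc _ _ (by omega) (by omega) hj)

theorem down_comm
    (hc : ∀ i j, 1 ≤ i → i + 2 ≤ j → j ≤ N → Commute (s i) (s j))
    (k j : ℕ) (h : k + 2 ≤ j) (hj : j ≤ N) : Commute (downProd s k) (s j) := by
  induction k with
  | zero => exact Commute.one_left _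
  | succ k ih => exact (hc _ _ (by omega) (by omega) hj).mul_left (ih (by omega))

theorem Q_succ (k : ℕ) : downProd s (k + 1) * upProd s (k + 1) =
    s (k + 1) * (downProd s k * upProd s k) * s (k + 1) := by
  simp [downProd, upProd, mul_assoc]

theorem sandwich (a b q : G) (h : a * b * a = b * a * b) (hq : Commute q b) :
    Commute a (b * (a * q * a) * b) := by
  show a * (b * (a * q * a) * b) = b * (a * q * a) * b * a
  calc _ = (a * b * a) * q * a * b := by group
    _ = b * a * (b * q) * a * b := by rw [h]; group
    _ = b * a * q * (b * a * b) := by rw [← hq.eq]; group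
    _ = _ := by rw [← h]; group

theorem Q_comm
    (hb : ∀ i, 1 ≤ i → i + 1 ≤ N → s i * s (i + 1) * s i = s (i + 1) * s i * s (i + 1))
    (hc : ∀ i j, 1 ≤ i → i + 2 ≤ j → j ≤ N → Commute (s i) (s j))
    (k i : ℕ) (h1 : 1 ≤ i) (h2 : i < k) (hk : k ≤ N) :
    Commute (s i) (downProd s k * upProd s k) := by
  induction k with
  | zero => omega
  | succ k ih =>
    rw [Q_succ]
    by_cases h : i < k
    · have := hc i (k + 1) h1 (by omega) hk
      exact (this.mul_right (ih h (by omega))).mul_right this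
    · obtain rfl : i = k := by omega
      obtain ⟨l, rfl⟩ : ∃ l, i = l + 1 := ⟨i - 1, by omega⟩
      rw [Q_succ]
      exact sandwich _ _ _ (hb _ h1 hk)
        ((down_comm s N hc _ _ (by omega) hk).mul_left (up_comm s N hc _ _ (by omega) hk))

theorem up_shift
    (hb : ∀ i, 1 ≤ i → i + 1 ≤ N → s i * s (i + 1) * s i = s (i + 1) * s i * s (i + 1))
    (hc : ∀ i j, 1 ≤ i → i + 2 ≤ j → j ≤ N → Commute (s i) (s j))
    (k j : ℕ) (h1 : 1 ≤ j) (h2 : j + 1 ≤ k) (hk : k ≤ N) :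
    s (j + 1) * upProd s k = upProd s k * s j := by
  induction k with
  | zero => omega
  | succ k ih =>
    by_cases h : j + 1 ≤ k
    · have := hc j (k + 1) h1 (by omega) hk
      rw [upProd, ← mul_assoc, ih h (by omega), mul_assoc, this.eq, mul_assoc]
    · obtain rfl : j = k := by omega
      obtain ⟨l, rfl⟩ : ∃ l, j = l + 1 := ⟨j - 1, by omega⟩
      rw [upProd, upProd]
      have e := (up_comm s N hc l (l + 1 + 1) (by omega) hk).eq
      calc _ = (s (l + 1 + 1) * upProd s l) * s (l + 1) * s (l + 1 + 1) := by group
        _ = upProd s l * (s (l + 1 + 1) * s (l + 1) * s (l + 1 + 1)) := by rw [← e]; group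
        _ = _ := by rw [← hb _ h1 hk]; group

theorem part_down (k j : ℕ) (h : j ≤ k) : partProd s k j * downProd s (k - j) = downProd s k := by
  induction j with
  | zero => simp [partProd]
  | succ j ih =>
    rw [← ih (by omega), partProd]
    obtain ⟨l, hl⟩ : ∃ l, k - j = l + 1 := ⟨k - j - 1, by omega⟩
    have : k - (j + 1) = l := by omega
    rw [this, hl, downProd, mul_assoc]

theorem part_W
    (hb : ∀ i, 1 ≤ i → i + 1 ≤ N → s i * s (i + 1) * s i = s (i + 1) * s i * s (i + 1))
    (hc : ∀ i j, 1 ≤ i → i + 2 ≤ j → j ≤ N → Commute (s i) (s j))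
    (k j : ℕ) (h : j + 1 ≤ k) (hk : k + 1 ≤ N) :
    partProd s (k + 1) j * (s 1 * upProd s (k + 1)) =
      s 1 * upProd s k * partProd s (k + 1) (j + 1) := by
  induction j with
  | zero => simp [partProd, upProd, mul_assoc]
  | succ j ih =>
    rw [partProd, partProd]
    obtain ⟨l, hl⟩ : ∃ l, k + 1 - j = l + 1 := ⟨k - j, by omega⟩
    have hl' : k + 1 - (j + 1) = l := by omega
    rw [hl, hl', ← mul_assoc (s 1 * upProd s k), ← ih (by omega)]
    have e := (hc 1 (l + 1) le_rfl (by omega) (by omega)).eq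
    have e2 := up_shift s N hb hc (k + 1) l (by omega) (by omega) hk
    calc _ = partProd s (k + 1) j * (s (l + 1) * s 1) * upProd s (k + 1) := by group
      _ = partProd s (k + 1) j * s 1 * (s (l + 1) * upProd s (k + 1)) := by rw [← e]; group
      _ = _ := by rw [e2]; group

theorem W_pow
    (hb : ∀ i, 1 ≤ i → i + 1 ≤ N → s i * s (i + 1) * s i = s (i + 1) * s i * s (i + 1))
    (hc : ∀ i j, 1 ≤ i → i + 2 ≤ j → j ≤ N → Commute (s i) (s j))
    (k j : ℕ) (h : j ≤ k) (hk : k + 1 ≤ N) :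
    (s 1 * upProd s (k + 1)) ^ j = (s 1 * upProd s k) ^ j * partProd s (k + 1) j := by
  induction j with
  | zero => simp [partProd]
  | succ j ih =>
    rw [pow_succ, ih (by omega), mul_assoc, part_W s N hb hc k j h hk, pow_succ]
    simp only [mul_assoc]

theorem W_full
    (hb : ∀ i, 1 ≤ i → i + 1 ≤ N → s i * s (i + 1) * s i = s (i + 1) * s i * s (i + 1))
    (hc : ∀ i j, 1 ≤ i → i + 2 ≤ j → j ≤ N → Commute (s i) (s j))
    (k : ℕ) (hk : k + 1 ≤ N) :
    (s 1 * upProd s (k + 1)) ^ (k + 1) =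
      (s 1 * upProd s k) ^ k * (downProd s (k + 1) * upProd s (k + 1)) := by
  rw [pow_succ, W_pow s N hb hc k k le_rfl hk, ← part_down s (k + 1) k (by omega)]
  simp [downProd, mul_assoc]

theorem X_conj (k j : ℕ) : s 1 * (upProd s k * s 1) ^ j = (s 1 * upProd s k) ^ j * s 1 := by
  induction j with
  | zero => simp
  | succ j ih => rw [pow_succ, ← mul_assoc, ih, pow_succ]; simp only [mul_assoc]

theorem X_full
    (hb : ∀ i, 1 ≤ i → i + 1 ≤ N → s i * s (i + 1) * s i = s (i + 1) * s i * s (i + 1))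
    (hc : ∀ i j, 1 ≤ i → i + 2 ≤ j → j ≤ N → Commute (s i) (s j))
    (k : ℕ) (h : 1 ≤ k) (hk : k + 1 ≤ N) :
    (upProd s (k + 1) * s 1) ^ (k + 1) =
      (upProd s k * s 1) ^ k * (downProd s (k + 1) * upProd s (k + 1)) := by
  apply mul_left_cancel (a := s 1)
  rw [X_conj, W_full s N hb hc k hk, ← mul_assoc (s 1), X_conj, mul_assoc,
    mul_assoc ((s 1 * upProd s k) ^ k) (s 1),
    (Q_comm s N hb hc (k + 1) 1 le_rfl (by omega) hk).eq]

theorem core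
    (hb : ∀ i, 1 ≤ i → i + 1 ≤ N → s i * s (i + 1) * s i = s (i + 1) * s i * s (i + 1))
    (hc : ∀ i j, 1 ≤ i → i + 2 ≤ j → j ≤ N → Commute (s i) (s j))
    (p : ℕ) (hp : 1 ≤ p) (hN : p + 2 ≤ N) :
    s (p + 2) * (upProd s (p + 1) * s 1) ^ p * (s (p + 2))⁻¹ * (upProd s (p + 1) * s 1) *
      s (p + 2) = (upProd s p * s 1) ^ p * (s 1)⁻¹ * (s (p + 1))⁻¹ * s 1 *
        (downProd s (p + 2) * upProd s (p + 2)) := by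
  have hfull := X_full s N hb hc p hp (by omega)
  have hQ1 := Q_comm s N hb hc (p + 2) 1 le_rfl (by omega) hN
  have hQu := Q_comm s N hb hc (p + 2) (p + 1) (by omega) (by omega) hN
  rw [Q_succ] at hQ1 hQu ⊢
  have hT : Commute ((upProd s p * s 1) ^ p) (s (p + 2)) :=
    ((up_comm s N hc p (p + 2) le_rfl hN).mul_left (hc 1 (p + 2) le_rfl (by omega) hN)).pow_left p
  have h1s := hc 1 (p + 2) le_rfl (by omega) hN
  have hus := hb (p + 1) (by omega) hN
  have hUs := up_comm s N hc p (p + 2) le_rfl hN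
  have hU : upProd s (p + 1) = upProd s p * s (p + 1) := rfl
  set T := (upProd s p * s 1) ^ p
  set P := downProd s (p + 1) * upProd s (p + 1)
  set X := upProd s (p + 1) * s 1 with hXdef
  have e1 : p + 1 + 1 = p + 2 := rfl
  rw [e1] at *
  set v := s (p + 2)
  set u := s (p + 1)
  set a := s 1
  set U := upProd s p
  have hXp : X ^ p = T * P * X⁻¹ := by rw [← hfull, pow_succ]; group
  have hR : a⁻¹ * u⁻¹ * a * (v * P * v) = (v * P * v) * (a⁻¹ * u⁻¹ * a) :=
    ((hQ1.inv_left.mul_left hQu.inv_left).mul_left hQ1).eq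
  have hX' : X⁻¹ * v⁻¹ * X = a⁻¹ * u⁻¹ * v⁻¹ * u * a := by
    have := hUs.inv_right.eq
    rw [hXdef, hU]
    calc _ = a⁻¹ * u⁻¹ * U⁻¹ * (v⁻¹ * U) * u * a := by group
      _ = _ := by rw [← this]; group
  have hbi : v⁻¹ * (u⁻¹ * v⁻¹) = u⁻¹ * v⁻¹ * u⁻¹ := by
    have := congrArg (·⁻¹) hus
    simp only [mul_inv_rev] at this
    rw [← this]; group
  have h1 : v⁻¹ * a⁻¹ = a⁻¹ * v⁻¹ := (h1s.inv_inv).eq.symm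
  have h2 : v⁻¹ * a = a * v⁻¹ := (h1s.inv_right).eq.symm
  calc _ = v * T * P * (X⁻¹ * v⁻¹ * X) * v := by rw [hXp]; group
    _ = T * v * P * v * (v⁻¹ * a⁻¹) * u⁻¹ * v⁻¹ * u * a * v := by rw [hX', ← hT.eq]; group
    _ = T * v * P * v * a⁻¹ * (v⁻¹ * (u⁻¹ * v⁻¹)) * u * a * v := by rw [h1]; group
    _ = T * v * P * v * a⁻¹ * u⁻¹ * (v⁻¹ * a) * v := by rw [hbi]; group
    _ = T * ((v * P * v) * (a⁻¹ * u⁻¹ * a)) := by rw [h2]; group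
    _ = _ := by rw [← hR]; group

theorem full
    (hb : ∀ i, 1 ≤ i → i + 1 ≤ N → s i * s (i + 1) * s i = s (i + 1) * s i * s (i + 1))
    (hc : ∀ i j, 1 ≤ i → i + 2 ≤ j → j ≤ N → Commute (s i) (s j))
    (p : ℕ) (hp : 1 ≤ p) (hN : p + 3 ≤ N) (Z : G)
    (hZ : ∀ i, 1 ≤ i → i ≤ p + 2 → Commute (s i) Z) (X Y : G)
    (hX : X = upProd s (p + 1) * s 1) (hY : Y = s (p + 2) * (s (p + 3) * Z) * s (p + 2)) :
    Y * X ^ p * Y⁻¹ * X * Y = (upProd s p * s 1) ^ p * (s 1)⁻¹ * (s (p + 1))⁻¹ * s 1 *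
        s (p + 3) * (downProd s (p + 2) * upProd s (p + 2)) * (s (p + 3) * Z) := by
  have hcore := core s N hb hc p hp (by omega)
  rw [← hX] at hcore
  have hst := hb (p + 2) (by omega) hN
  have e1 : p + 2 + 1 = p + 3 := rfl
  rw [e1] at hst
  have hUp : ∀ k, k ≤ p + 1 → Commute (upProd s k) Z := by
    intro k hk
    induction k with
    | zero => exact Commute.one_left _
    | succ k ih => exact (ih (by omega)).mul_left (hZ _ (by omega) (by omega))
  have hXZ : Commute X Z := by
    rw [hX]; exact (hUp _ le_rfl).mul_left (hZ 1 le_rfl (by omega))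
  have hXt : Commute X (s (p + 3)) := by
    rw [hX]
    exact (up_comm s N hc _ _ (by omega) hN).mul_left (hc _ _ le_rfl (by omega) hN)
  have hTt : Commute (s (p + 3)) ((upProd s p * s 1) ^ p * (s 1)⁻¹ * (s (p + 1))⁻¹ * s 1) := by
    have h1 := (hc 1 (p + 3) le_rfl (by omega) hN).symm
    have hu := (hc (p + 1) (p + 3) (by omega) (by omega) hN).symm
    have hU := (up_comm s N hc p (p + 3) (by omega) hN).symm
    exact ((((hU.mul_right h1).pow_right p).mul_right h1.inv_right).mul_right
      hu.inv_right).mul_right h1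
  have hvZ := hZ (p + 2) (by omega) le_rfl
  set R := (upProd s p * s 1) ^ p * (s 1)⁻¹ * (s (p + 1))⁻¹ * s 1
  set Q := downProd s (p + 2) * upProd s (p + 2)
  set v := s (p + 2)
  set t := s (p + 3)
  have hY' : Y = t * v * t * Z := by
    rw [hY, ← hst]
    calc _ = v * t * (Z * v) := by group
      _ = _ := by rw [← hvZ.eq]; group
  have hXpZ := (hXZ.pow_left p).eq
  have hXpt := (hXt.pow_left p).eq
  have hXt' := hXt.inv_right.eq
  calc _ = t * v * t * (Z * X ^ p) * Z⁻¹ * t⁻¹ * v⁻¹ * t⁻¹ * X * (t * v * t * Z) := by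
          rw [hY']; group
    _ = t * v * (t * X ^ p) * t⁻¹ * v⁻¹ * (t⁻¹ * X) * (t * v * t * Z) := by rw [← hXpZ]; group
    _ = t * (v * X ^ p * v⁻¹ * X * v) * t * Z := by rw [← hXpt, ← hXt']; group
    _ = (t * R) * Q * t * Z := by rw [hcore]; group
    _ = _ := by rw [hTt.eq]; group

end abstractBraid

theorem sigmaI_one (m k : ℕ) : σI m 1 k = upProd (σ m) k := by
  induction k with
  | zero => simp [σI, upProd]
  | succ k ih =>
    rw [upProd, ← ih]
    simp [σI, List.range'_concat, add_comm]

theorem sigmaIrev_one (m k : ℕ) : σIrev m 1 k = downProd (σ m) k := by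
  induction k with
  | zero => simp [σIrev, downProd]
  | succ k ih =>
    rw [downProd, ← ih]
    simp [σIrev, List.range'_concat, add_comm]

theorem sigmaI_cons (m i j : ℕ) (h : i ≤ j) : σI m i j = σ m i * σI m (i + 1) j := by
  have : j + 1 - i = (j + 1 - (i + 1)) + 1 := by omega
  rw [σI, this, List.range'_succ]
  simp [σI]

/-- For `p, q ≥ 1`, `n = p + q + 1`, in `B_{n+2}` with
`X = σ_{[1,p+1]} σ_1` and `Y = σ_{[p+2,n+1]} σ_{p+2}`, we have
`Y X^p Y⁻¹ X Y = twist_{p+1} σ_1⁻¹ σ_{p+1}⁻¹ σ_1 σ_{p+3} push_{p+3} σ_{[p+3,n+1]}`. -/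
theorem magic_word_identity (p q : ℕ) (hp : 1 ≤ p) (hq : 1 ≤ q) (n : ℕ)
    (hn : n = p + q + 1) (X Y : BraidGroup (n + 2))
    (hX : X = σI (n + 2) 1 (p + 1) * σ (n + 2) 1)
    (hY : Y = σI (n + 2) (p + 2) (n + 1) * σ (n + 2) (p + 2)) :
    Y * X ^ p * Y⁻¹ * X * Y =
      twist (n + 2) (p + 1) * (σ (n + 2) 1)⁻¹ * (σ (n + 2) (p + 1))⁻¹ * σ (n + 2) 1 *
        σ (n + 2) (p + 3) * push (n + 2) (p + 3) * σI (n + 2) (p + 3) (n + 1) := by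
  have hb : ∀ i, 1 ≤ i → i + 1 ≤ n + 1 → σ (n + 2) i * σ (n + 2) (i + 1) * σ (n + 2) i =
      σ (n + 2) (i + 1) * σ (n + 2) i * σ (n + 2) (i + 1) :=
    fun i h1 h2 => sigma_braid _ i h1 (by omega)
  have hc : ∀ i j, 1 ≤ i → i + 2 ≤ j → j ≤ n + 1 → Commute (σ (n + 2) i) (σ (n + 2) j) :=
    fun i j h1 h2 h3 => sigma_comm _ i j h1 h2 (by omega)
  have hZ : ∀ i, 1 ≤ i → i ≤ p + 2 → Commute (σ (n + 2) i) (σI (n + 2) (p + 4) (n + 1)) := by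
    intro i h1 h2
    apply Commute.list_prod_right
    intro y hy
    obtain ⟨j, hj, rfl⟩ := List.mem_map.1 hy
    rw [List.mem_range'_1] at hj
    exact hc i j h1 (by omega) (by omega)
  rw [sigmaI_one] at hX
  rw [sigmaI_cons _ (p + 2) _ (by omega), sigmaI_cons _ (p + 2 + 1) _ (by omega)] at hY
  rw [sigmaI_cons _ (p + 3) _ (by omega), twist, push, sigmaI_one, sigmaI_one, sigmaIrev_one]
  exact full (σ (n + 2)) (n + 1) hb hc p hp (by omega) _ hZ X Y hX hY
end
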